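/- Fix β > 0. Almost surely, lim_{d→∞} s_1(A_d) = 1 and lim_{d→∞} s_1( exp(β S_d)/(e^{β²/2} d) ) = 1, where exp is applied entrywise. -/

import Mathlib

open MeasureTheory ProbabilityTheory Filter Matrix Real

/-- Descending singular values: `sVal M i` is the `(i+1)`-st largest singular value of `M`. -/
noncomputable def sVal {d : ℕ} (M : Matrix (Fin d) (Fin d) ℝ) (i : Fin d) : ℝ :=
  Real.sqrt ((Matrix.isHermitian_mul_conjTranspose_self M).eigenvalues
    (Tuple.sort (Matrix.isHermitian_mul_conjTranspose_self M).eigenvalues i.rev))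

/-- The largest singular value of `M` (the operator norm of `M`). -/
noncomputable def sOne {d : ℕ} (M : Matrix (Fin d) (Fin d) ℝ) : ℝ := ⨆ i, sVal M i

/-- The score matrix `S_d = W^Q_d (W^K_d)ᵀ / √d`. -/
noncomputable def scoreS {Ω : Type*} (WQ WK : (d : ℕ) → Ω → Fin d → Fin d → ℝ)
    (d : ℕ) (ω : Ω) : Matrix (Fin d) (Fin d) ℝ :=
  (Real.sqrt d)⁻¹ • (Matrix.of (WQ d ω) * (Matrix.of (WK d ω))ᵀ)

/-- The attention matrix `A_d` with entries `exp(β S_ij) / Z_i`,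
where `Z_i = Σ_j exp(β S_ij)`. -/
noncomputable def attn {Ω : Type*} (β : ℝ) (WQ WK : (d : ℕ) → Ω → Fin d → Fin d → ℝ)
    (d : ℕ) (ω : Ω) : Matrix (Fin d) (Fin d) ℝ :=
  Matrix.of fun i j =>
    Real.exp (β * scoreS WQ WK d ω i j) / ∑ k, Real.exp (β * scoreS WQ WK d ω i k)


section OperatorNorm

open scoped Matrix.Norms.L2Operator

lemma sOne_eq_norm {d : ℕ} (M : Matrix (Fin d) (Fin d) ℝ) : sOne M = ‖M‖ := by
  set hA := Matrix.isHermitian_mul_conjTranspose_self M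
  have hnorm : ‖hA.eigenvalues‖ = ‖M‖ ^ 2 := by
    have h1 : ‖M * Mᴴ‖ = ‖M‖ ^ 2 := by
      have := l2_opNorm_conjTranspose_mul_self Mᴴ
      rw [conjTranspose_conjTranspose, l2_opNorm_conjTranspose] at this
      rw [this, sq]
    rw [← h1]
    conv_rhs => rw [hA.spectral_theorem]
    rw [Unitary.conjStarAlgAut_apply, ← Unitary.coe_star, CStarRing.norm_mul_coe_unitary,
      CStarRing.norm_coe_unitary_mul, l2_opNorm_diagonal]
    rfl
  have hnn : ∀ j, 0 ≤ hA.eigenvalues j :=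
    (Matrix.posSemidef_self_mul_conjTranspose M).eigenvalues_nonneg
  have hle : ∀ i, sVal M i ≤ ‖M‖ := fun i => by
    refine Real.sqrt_le_iff.2 ⟨norm_nonneg _, ?_⟩
    rw [← hnorm]
    exact (le_abs_self _).trans (norm_le_pi_norm hA.eigenvalues _)
  have hbdd : BddAbove (Set.range (sVal M)) := ⟨‖M‖, by rintro _ ⟨i, rfl⟩; exact hle i⟩
  have h0 : 0 ≤ sOne M := Real.iSup_nonneg fun i => Real.sqrt_nonneg _
  refine le_antisymm (Real.iSup_le hle (norm_nonneg _)) ?_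
  refine le_of_sq_le_sq ?_ h0
  rw [← hnorm, pi_norm_le_iff_of_nonneg (sq_nonneg _)]
  intro j
  rw [Real.norm_of_nonneg (hnn j), ← Real.sq_sqrt (hnn j)]
  refine pow_le_pow_left₀ (Real.sqrt_nonneg _) ?_ 2
  have := le_ciSup hbdd (Fin.rev ((Tuple.sort hA.eigenvalues).symm j))
  refine le_trans (le_of_eq ?_) this
  simp [sVal]

lemma norm_le_of_sum_sq_le {m n : Type*} [Fintype m] [Fintype n] [DecidableEq n]
    (B : Matrix m n ℝ) {c : ℝ} (hc : 0 ≤ c) (h : ∑ i, ∑ k, B i k ^ 2 ≤ c ^ 2) : ‖B‖ ≤ c := by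
  rw [l2_opNorm_def]
  refine ContinuousLinearMap.opNorm_le_bound _ hc fun x => ?_
  refine le_of_sq_le_sq ?_ (by positivity)
  rw [EuclideanSpace.norm_sq_eq, mul_pow, EuclideanSpace.norm_sq_eq]
  simp only [Real.norm_eq_abs, sq_abs]
  refine le_trans ?_ (mul_le_mul_of_nonneg_right h (Finset.sum_nonneg fun i _ => sq_nonneg _))
  rw [Finset.sum_mul]
  refine Finset.sum_le_sum fun i _ => ?_
  exact Finset.sum_mul_sq_le_sq_mul_sq Finset.univ (B i) x

lemma norm_const_inv_card {d : ℕ} (hd : d ≠ 0) :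
    ‖(Matrix.of fun _ _ => (d : ℝ)⁻¹ : Matrix (Fin d) (Fin d) ℝ)‖ = 1 := by
  set P : Matrix (Fin d) (Fin d) ℝ := Matrix.of fun _ _ => (d : ℝ)⁻¹ with hP
  have hd' : (d : ℝ) ≠ 0 := by exact_mod_cast hd
  have hPP : Pᴴ * P = P := by
    ext i j
    simp [hP, Matrix.mul_apply, hd']
  have h1 := l2_opNorm_conjTranspose_mul_self P
  rw [hPP] at h1
  have hne : ‖P‖ ≠ 0 := by
    rw [norm_ne_zero_iff]
    intro h
    have := congrFun (congrFun h ⟨0, Nat.pos_of_ne_zero hd⟩) ⟨0, Nat.pos_of_ne_zero hd⟩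
    simp [hP, hd'] at this
  exact (mul_left_cancel₀ hne (by rw [mul_one]; exact h1)).symm

lemma abs_norm_sq_sub_one_le {d : ℕ} (hd : d ≠ 0) (E : Matrix (Fin d) (Fin d) ℝ) {ε C : ℝ}
    (hε : 0 ≤ ε) (hC : 0 ≤ C)
    (hoff : ∀ i k, i ≠ k → |d * (E * Eᵀ) i k - 1| ≤ ε)
    (hdiag : ∀ i, |d * (E * Eᵀ) i i - 1| ≤ C) :
    |‖E‖ ^ 2 - 1| ≤ ε + C / √d := by
  have hd' : (0 : ℝ) < d := by exact_mod_cast Nat.pos_of_ne_zero hd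
  have h1 : ‖E * Eᵀ‖ = ‖E‖ ^ 2 := by
    have := l2_opNorm_conjTranspose_mul_self Eᴴ
    rw [conjTranspose_conjTranspose, l2_opNorm_conjTranspose] at this
    rw [← conjTranspose_eq_transpose_of_trivial, this, sq]
  rw [← h1, ← norm_const_inv_card hd]
  refine (abs_norm_sub_norm_le _ _).trans ?_
  refine norm_le_of_sum_sq_le _ (by positivity) ?_
  have key : ∀ i k, ((E * Eᵀ - Matrix.of fun _ _ => (d : ℝ)⁻¹ : Matrix (Fin d) (Fin d) ℝ) i k) ^ 2 ≤
      (ε ^ 2 + if i = k then C ^ 2 else 0) / d ^ 2 := by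
    intro i k
    have h2 : (E * Eᵀ - Matrix.of fun _ _ => (d : ℝ)⁻¹ : Matrix (Fin d) (Fin d) ℝ) i k = (d * (E * Eᵀ) i k - 1) / d := by
      simp only [Matrix.sub_apply, Matrix.of_apply]
      field_simp
    rw [h2, div_pow]
    gcongr
    split_ifs with h
    · subst h
      have := sq_le_sq' (abs_le.1 (hdiag i)).1 (abs_le.1 (hdiag i)).2
      nlinarith
    · have := sq_le_sq' (abs_le.1 (hoff i k h)).1 (abs_le.1 (hoff i k h)).2
      linarith
  calc _ ≤ ∑ i : Fin d, ∑ k : Fin d, (ε ^ 2 + if i = k then C ^ 2 else 0) / (d : ℝ) ^ 2 :=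
        Finset.sum_le_sum fun i _ => Finset.sum_le_sum fun k _ => key i k
    _ = ε ^ 2 + C ^ 2 / d := by
        simp only [← Finset.sum_div, Finset.sum_add_distrib, Finset.sum_const, Finset.card_univ,
          Fintype.card_fin, Finset.sum_ite_eq, Finset.mem_univ, if_true, nsmul_eq_mul]
        field_simp
    _ ≤ (ε + C / √d) ^ 2 := by
        have h3 : (C / √d) ^ 2 = C ^ 2 / d := by rw [div_pow, Real.sq_sqrt hd'.le]
        have h4 : 0 ≤ ε * (C / √d) := by positivity
        nlinarith

lemma norm_of_div_le {d : ℕ} (E : Matrix (Fin d) (Fin d) ℝ) (D : Fin d → ℝ) {c : ℝ} (hc : 0 < c)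
    (hD : ∀ i, c ≤ D i) : ‖(Matrix.of fun i j => E i j / D i)‖ ≤ ‖E‖ / c := by
  have h : (Matrix.of fun i j => E i j / D i) = Matrix.diagonal (fun i => (D i)⁻¹) * E := by
    ext i j
    simp [Matrix.diagonal_mul, div_eq_inv_mul]
  rw [h, div_eq_inv_mul]
  refine (l2_opNorm_mul _ _).trans (mul_le_mul_of_nonneg_right ?_ (norm_nonneg _))
  rw [l2_opNorm_diagonal, pi_norm_le_iff_of_nonneg (by positivity)]
  intro i
  rw [Real.norm_of_nonneg (inv_nonneg.2 (hc.le.trans (hD i)))]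
  exact inv_anti₀ hc (hD i)

end OperatorNorm

section Moments

variable {Ω : Type*} {mΩ : MeasurableSpace Ω} {P : Measure Ω} [IsProbabilityMeasure P]

lemma integrable_pow_of_forall_memLp {X : Ω → ℝ} (hX : ∀ l : ℕ, MemLp X l P) (l : ℕ) :
    Integrable (fun ω => X ω ^ l) P := by
  refine ((hX l).integrable_norm_pow').mono ((hX l).aestronglyMeasurable.pow l) ?_
  exact ae_of_all _ fun ω => by simp

lemma abs_integral_pow_le {X : Ω → ℝ} (hX : ∀ l : ℕ, MemLp X l P) {k m : ℕ} (hm : m ≤ 2 * k) :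
    |∫ ω, X ω ^ m ∂P| ≤ ∫ ω, X ω ^ (2 * k) ∂P + 1 := by
  refine (abs_integral_le_integral_abs).trans ?_
  have h1 : ∫ ω, X ω ^ (2 * k) ∂P + 1 = ∫ ω, (X ω ^ (2 * k) + 1) ∂P := by
    rw [integral_add (integrable_pow_of_forall_memLp hX _) (integrable_const _)]
    simp
  rw [h1]
  refine integral_mono (integrable_pow_of_forall_memLp hX m).abs
    ((integrable_pow_of_forall_memLp hX _).add (integrable_const _)) fun ω => ?_
  simp only [abs_pow]
  rw [← Even.pow_abs (even_two_mul k)]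
  rcases le_total |X ω| 1 with h | h
  · exact (pow_le_one₀ (abs_nonneg _) h).trans (by simp)
  · exact (pow_le_pow_right₀ h hm).trans (by simp)

lemma integral_add_pow_le {T X : Ω → ℝ} (hT : ∀ l : ℕ, MemLp T l P) (hX : ∀ l : ℕ, MemLp X l P)
    (hTX : IndepFun T X P) (hX0 : ∫ ω, X ω ∂P = 0) {B : ℝ} (k : ℕ)
    (hB : ∀ l ≤ 2 * (k + 1), |∫ ω, X ω ^ l ∂P| ≤ B) :
    ∫ ω, (T ω + X ω) ^ (2 * (k + 1)) ∂P ≤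
      ∫ ω, T ω ^ (2 * (k + 1)) ∂P + 4 ^ (k + 1) * (B * (∫ ω, T ω ^ (2 * k) ∂P + 1)) := by
  set n := 2 * (k + 1) with hn
  have hB0 : 0 ≤ B := (abs_nonneg _).trans (hB 0 (Nat.zero_le _))
  have hM0 : 0 ≤ ∫ ω, T ω ^ (2 * k) ∂P + 1 := (abs_nonneg _).trans
    (abs_integral_pow_le hT (Nat.zero_le (2 * k)))
  have hind : ∀ a b : ℕ, IndepFun (fun ω => T ω ^ a) (fun ω => X ω ^ b) P := fun a b =>
    hTX.comp (φ := fun x : ℝ => x ^ a) (ψ := fun x : ℝ => x ^ b) (by fun_prop) (by fun_prop)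
  have hint : ∀ a b : ℕ, Integrable (fun ω => T ω ^ a * X ω ^ b) P := fun a b =>
    (hind a b).integrable_mul (integrable_pow_of_forall_memLp hT a)
      (integrable_pow_of_forall_memLp hX b)
  have hmul : ∀ a b : ℕ, ∫ ω, T ω ^ a * X ω ^ b ∂P = (∫ ω, T ω ^ a ∂P) * ∫ ω, X ω ^ b ∂P :=
    fun a b => (hind a b).integral_fun_mul_eq_mul_integral
      (integrable_pow_of_forall_memLp hT a).aestronglyMeasurable
      (integrable_pow_of_forall_memLp hX b).aestronglyMeasurable
  simp_rw [add_pow]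
  rw [integral_finsetSum _ fun m _ => (hint m (n - m)).mul_const _]
  simp_rw [integral_mul_const, hmul]
  rw [Finset.sum_range_succ]
  have hlast : (∫ ω, T ω ^ n ∂P) * (∫ ω, X ω ^ (n - n) ∂P) * (n.choose n : ℝ)
      = ∫ ω, T ω ^ n ∂P := by simp
  rw [hlast, add_comm]
  gcongr
  calc ∑ m ∈ Finset.range n, (∫ ω, T ω ^ m ∂P) * (∫ ω, X ω ^ (n - m) ∂P) * (n.choose m : ℝ)
      ≤ ∑ m ∈ Finset.range n, (B * (∫ ω, T ω ^ (2 * k) ∂P + 1)) * (n.choose m : ℝ) := by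
        refine Finset.sum_le_sum fun m hm => ?_
        have hmn := Finset.mem_range.1 hm
        refine mul_le_mul_of_nonneg_right ?_ (Nat.cast_nonneg _)
        rcases Nat.lt_or_ge m (2 * k + 1) with h | h
        · refine (le_abs_self _).trans ?_
          rw [abs_mul, mul_comm]
          exact mul_le_mul (hB _ (Nat.sub_le _ _)) (abs_integral_pow_le hT (by omega))
            (abs_nonneg _) hB0
        · have : n - m = 1 := by omega
          rw [this]
          simp only [pow_one, hX0, mul_zero]
          positivity
    _ ≤ ∑ m ∈ Finset.range (n + 1), (B * (∫ ω, T ω ^ (2 * k) ∂P + 1)) * (n.choose m : ℝ) :=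
        Finset.sum_le_sum_of_subset_of_nonneg (Finset.range_mono (Nat.le_succ n))
          fun m _ _ => by positivity
    _ = 4 ^ (k + 1) * (B * (∫ ω, T ω ^ (2 * k) ∂P + 1)) := by
        rw [← Finset.mul_sum, ← Nat.cast_sum, Nat.sum_range_choose, hn, pow_mul]
        push_cast
        ring

/-- The constant in the bound for even moments of sums of independent centred variables. -/
def evenMomentConst (B : ℝ) : ℕ → ℝ
  | 0 => 1
  | k + 1 => 4 ^ (k + 1) * (B * (evenMomentConst B k + 1))

lemma evenMomentConst_nonneg {B : ℝ} (hB : 0 ≤ B) (k : ℕ) : 0 ≤ evenMomentConst B k := by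
  induction k with
  | zero => exact zero_le_one
  | succ k ih => rw [evenMomentConst]; positivity

lemma integral_sum_pow_le {ι : Type*} {X : ι → Ω → ℝ} (hind : iIndepFun X P)
    (hmeas : ∀ i, Measurable (X i)) (hX : ∀ i, ∀ l : ℕ, MemLp (X i) l P)
    (hX0 : ∀ i, ∫ ω, X i ω ∂P = 0) {B : ℝ} (k : ℕ)
    (hB : ∀ i, ∀ l ≤ 2 * k, |∫ ω, X i ω ^ l ∂P| ≤ B) (hB0 : 0 ≤ B) (s : Finset ι) :
    ∫ ω, (∑ i ∈ s, X i ω) ^ (2 * k) ∂P ≤ evenMomentConst B k * (s.card : ℝ) ^ k := by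
  classical
  induction k generalizing s with
  | zero => simp [evenMomentConst]
  | succ k ih =>
    have ih' := ih fun i l hl => hB i l (by omega)
    have hC : 0 ≤ evenMomentConst B (k + 1) := evenMomentConst_nonneg hB0 _
    have hC' : 0 ≤ evenMomentConst B k := evenMomentConst_nonneg hB0 _
    induction s using Finset.induction_on with
    | empty => simp
    | insert a s ha ihs =>
      have hTX : IndepFun (fun ω => ∑ i ∈ s, X i ω) (X a) P := by
        have := hind.indepFun_finsetSum_of_notMem hmeas ha
        convert this using 1
        ext ω; simp
      have hstep := integral_add_pow_le (fun l => memLp_finsetSum s fun i _ => hX i l) (hX a) hTX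
        (hX0 a) k (hB a)
      have hsum : ∀ ω, ∑ i ∈ insert a s, X i ω = ∑ i ∈ s, X i ω + X a ω := fun ω => by
        rw [Finset.sum_insert ha, add_comm]
      simp_rw [hsum]
      rw [Finset.card_insert_of_notMem ha]
      push_cast
      set N : ℝ := (s.card : ℝ)
      have hN : 0 ≤ N := Nat.cast_nonneg _
      have h1 : ∫ ω, (∑ i ∈ s, X i ω) ^ (2 * k) ∂P + 1 ≤
          (evenMomentConst B k + 1) * (N + 1) ^ k := by
        have h2 : N ^ k ≤ (N + 1) ^ k := by gcongr; linarith
        have h3 : 1 ≤ (N + 1) ^ k := one_le_pow₀ (by linarith)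
        have h4 := mul_le_mul_of_nonneg_left h2 hC'
        linarith [ih' s]
      calc _ ≤ _ := hstep
        _ ≤ evenMomentConst B (k + 1) * N ^ (k + 1) +
            4 ^ (k + 1) * (B * ((evenMomentConst B k + 1) * (N + 1) ^ k)) := by gcongr
        _ = evenMomentConst B (k + 1) * (N * N ^ k + (N + 1) ^ k) := by
            rw [evenMomentConst]; ring
        _ ≤ evenMomentConst B (k + 1) * (N * (N + 1) ^ k + (N + 1) ^ k) := by
            gcongr; linarith
        _ = _ := by ring

lemma measureReal_abs_mean_gt_le {n : ℕ} (hn : n ≠ 0) {X : Fin n → Ω → ℝ} (hind : iIndepFun X P)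
    (hmeas : ∀ i, Measurable (X i)) (hX : ∀ i, ∀ l : ℕ, MemLp (X i) l P)
    (hX0 : ∀ i, ∫ ω, X i ω ∂P = 0) {B : ℝ} (k : ℕ)
    (hB : ∀ i, ∀ l ≤ 2 * k, |∫ ω, X i ω ^ l ∂P| ≤ B) (hB0 : 0 ≤ B) {ε : ℝ} (hε : 0 < ε) :
    P.real {ω | ε < |(n : ℝ)⁻¹ * ∑ i, X i ω|} ≤
      evenMomentConst B k / ε ^ (2 * k) / (n : ℝ) ^ k := by
  have hn' : (0 : ℝ) < n := by exact_mod_cast Nat.pos_of_ne_zero hn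
  have hmom := integral_sum_pow_le hind hmeas hX hX0 k hB hB0 Finset.univ
  rw [Finset.card_univ, Fintype.card_fin] at hmom
  have hM := mul_meas_ge_le_integral_of_nonneg (μ := P) (f := fun ω => (∑ i, X i ω) ^ (2 * k))
    (ae_of_all _ fun ω => (even_two_mul k).pow_nonneg _)
    (integrable_pow_of_forall_memLp (fun l => memLp_finsetSum Finset.univ fun i _ => hX i l) _)
    ((ε * n) ^ (2 * k))
  have hsub : P.real {ω | ε < |(n : ℝ)⁻¹ * ∑ i, X i ω|} ≤
      P.real {ω | (ε * n) ^ (2 * k) ≤ (∑ i, X i ω) ^ (2 * k)} := by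
    refine measureReal_mono fun ω hω => ?_
    simp only [Set.mem_ofPred_eq, abs_mul, abs_inv, Nat.abs_cast] at hω ⊢
    rw [← Even.pow_abs (even_two_mul k) (∑ i, X i ω)]
    rw [inv_mul_eq_div, lt_div_iff₀ hn'] at hω
    gcongr
  have hpos : 0 < (ε * n) ^ (2 * k) := by positivity
  refine hsub.trans ?_
  rw [div_div, le_div_iff₀ (by positivity)]
  have h2 : (ε * n) ^ (2 * k) = ε ^ (2 * k) * (n : ℝ) ^ k * (n : ℝ) ^ k := by
    rw [mul_pow, two_mul, pow_add (n : ℝ)]; ring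
  have h3 := hM.trans hmom
  rw [h2] at h3
  rw [← mul_le_mul_iff_left₀ (show (0 : ℝ) < (n : ℝ) ^ k by positivity)]
  rw [h2]
  linarith

end Moments

section Gaussian

/-- The standard Gaussian measure on `Fin d → ℝ`. -/
noncomputable abbrev gaussianPi (d : ℕ) : Measure (Fin d → ℝ) :=
  Measure.pi fun _ => gaussianReal 0 1

lemma memLp_of_forall_integrable_pow {Ω : Type*} {mΩ : MeasurableSpace Ω} {P : Measure Ω}
    {X : Ω → ℝ} (hm : AEStronglyMeasurable X P) (h : ∀ l : ℕ, Integrable (fun ω => X ω ^ l) P)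
    (l : ℕ) : MemLp X l P := by
  rcases eq_or_ne l 0 with rfl | hl
  · simpa using hm
  rw [← integrable_norm_rpow_iff hm (by simpa using hl) (by simp)]
  simpa using (h l).norm

lemma integrable_exp_dot {d : ℕ} (w : Fin d → ℝ) :
    Integrable (fun x : Fin d → ℝ => Real.exp (∑ m, w m * x m)) (gaussianPi d) := by
  simp_rw [Real.exp_sum]
  exact Integrable.fintype_prod (f := fun m x => Real.exp (w m * x))
    fun m => integrable_exp_mul_gaussianReal _

lemma integral_exp_dot {d : ℕ} (w : Fin d → ℝ) :
    ∫ x : Fin d → ℝ, Real.exp (∑ m, w m * x m) ∂(gaussianPi d) =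
      Real.exp ((∑ m, w m ^ 2) / 2) := by
  simp_rw [Real.exp_sum]
  rw [integral_fintype_prod_eq_prod (f := fun m x => Real.exp (w m * x)), Finset.sum_div,
    Real.exp_sum]
  refine Finset.prod_congr rfl fun m _ => ?_
  have := congrFun (mgf_id_gaussianReal (μ := 0) (v := 1)) (w m)
  simpa [mgf] using this

lemma exp_dot_pow {d : ℕ} (w x : Fin d → ℝ) (l : ℕ) :
    Real.exp (∑ m, w m * x m) ^ l = Real.exp (∑ m, (l * w m) * x m) := by
  rw [← Real.exp_nat_mul, Finset.mul_sum]
  simp_rw [mul_assoc]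

lemma memLp_exp_dot {d : ℕ} (w : Fin d → ℝ) (l : ℕ) :
    MemLp (fun x : Fin d → ℝ => Real.exp (∑ m, w m * x m)) l (gaussianPi d) := by
  refine memLp_of_forall_integrable_pow (integrable_exp_dot w).aestronglyMeasurable
    (fun l => ?_) l
  simp_rw [exp_dot_pow]
  exact integrable_exp_dot _

lemma abs_integral_exp_dot_sub_pow_le {d : ℕ} (w : Fin d → ℝ) {R : ℝ}
    (hR : (∑ m, w m ^ 2) / 2 ≤ R) {l N : ℕ} (hl : l ≤ N) :
    |∫ x : Fin d → ℝ, (Real.exp (∑ m, w m * x m) - Real.exp ((∑ m, w m ^ 2) / 2)) ^ l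
      ∂(gaussianPi d)| ≤ 2 * Real.exp (N ^ 2 * R) := by
  set r := (∑ m, w m ^ 2) / 2 with hr
  have hr0 : 0 ≤ r := by positivity
  have hint : Integrable (fun x : Fin d → ℝ =>
      Real.exp (∑ m, (l * w m) * x m) + Real.exp r ^ l) (gaussianPi d) :=
    (integrable_exp_dot _).add (integrable_const _)
  have h1 : |∫ x : Fin d → ℝ, (Real.exp (∑ m, w m * x m) - Real.exp r) ^ l ∂(gaussianPi d)| ≤
      ∫ x : Fin d → ℝ, (Real.exp (∑ m, (l * w m) * x m) + Real.exp r ^ l) ∂(gaussianPi d) := by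
    rw [← Real.norm_eq_abs]
    refine norm_integral_le_of_norm_le hint (ae_of_all _ fun x => ?_)
    rw [Real.norm_eq_abs, abs_pow, ← exp_dot_pow]
    have ha : 0 < Real.exp (∑ m, w m * x m) := Real.exp_pos _
    have hb : 0 < Real.exp r := Real.exp_pos _
    rcases le_total (Real.exp (∑ m, w m * x m)) (Real.exp r) with h | h
    · rw [abs_of_nonpos (by linarith)]
      have : (-(Real.exp (∑ m, w m * x m) - Real.exp r)) ^ l ≤ Real.exp r ^ l :=
        pow_le_pow_left₀ (by linarith) (by linarith) l
      have := pow_pos ha l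
      linarith
    · rw [abs_of_nonneg (by linarith)]
      have : (Real.exp (∑ m, w m * x m) - Real.exp r) ^ l ≤ Real.exp (∑ m, w m * x m) ^ l :=
        pow_le_pow_left₀ (by linarith) (by linarith) l
      have := pow_pos hb l
      linarith
  refine h1.trans ?_
  rw [integral_add (integrable_exp_dot _) (integrable_const _), integral_exp_dot]
  have h2 : (∑ m, (l * w m) ^ 2) / 2 = (l : ℝ) ^ 2 * r := by
    simp_rw [mul_pow, ← Finset.mul_sum, hr]
    ring
  have hlN : (l : ℝ) ^ 2 ≤ (N : ℝ) ^ 2 := by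
    have : (l : ℝ) ≤ N := by exact_mod_cast hl
    gcongr
  have hll : (l : ℝ) ≤ (l : ℝ) ^ 2 := by exact_mod_cast Nat.le_self_pow two_ne_zero l
  have h3 : (l : ℝ) ^ 2 * r ≤ N ^ 2 * R := by gcongr
  have h4 : (l : ℝ) * r ≤ N ^ 2 * R := (mul_le_mul_of_nonneg_right hll hr0).trans h3
  rw [h2, integral_const, ← Real.exp_nat_mul]
  have := Real.exp_le_exp.2 h3
  have := Real.exp_le_exp.2 h4
  simp only [probReal_univ, smul_eq_mul, one_mul]
  linarith

lemma measureReal_abs_mean_exp_dot_sub_gt_le {d : ℕ} (hd : d ≠ 0) (w : Fin d → ℝ) {R : ℝ}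
    (hR : (∑ m, w m ^ 2) / 2 ≤ R) (k : ℕ) {ε : ℝ} (hε : 0 < ε) :
    (Measure.pi fun _ : Fin d => gaussianPi d).real
      {K | ε < |(d : ℝ)⁻¹ * ∑ j, Real.exp (∑ m, w m * K j m) - Real.exp ((∑ m, w m ^ 2) / 2)|} ≤
      evenMomentConst (2 * Real.exp ((2 * k : ℕ) ^ 2 * R)) k / ε ^ (2 * k) / (d : ℝ) ^ k := by
  have hd' : (d : ℝ) ≠ 0 := by exact_mod_cast hd
  set f : (Fin d → ℝ) → ℝ := fun x =>
    Real.exp (∑ m, w m * x m) - Real.exp ((∑ m, w m ^ 2) / 2) with hf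
  have hfm : Measurable f := by fun_prop
  have hfL : ∀ l : ℕ, MemLp f l (gaussianPi d) := fun l =>
    (memLp_exp_dot w l).sub (memLp_const _)
  have hf0 : ∫ x, f x ∂(gaussianPi d) = 0 := by
    rw [hf, integral_sub (integrable_exp_dot w) (integrable_const _), integral_exp_dot]
    simp
  have key := measureReal_abs_mean_gt_le (P := Measure.pi fun _ : Fin d => gaussianPi d) hd
    (X := fun j K => f (K j)) (iIndepFun_pi fun j => hfm.aemeasurable)
    (fun j => hfm.comp (measurable_pi_apply j))
    (fun j l => (hfL l).comp_measurePreserving (measurePreserving_eval _ j))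
    (fun j => by
      rw [integral_comp_eval (μ := fun _ : Fin d => gaussianPi d) hfm.aestronglyMeasurable]
      exact hf0)
    k (B := 2 * Real.exp ((2 * k : ℕ) ^ 2 * R))
    (fun j l hl => by
      rw [integral_comp_eval (μ := fun _ : Fin d => gaussianPi d) (f := fun x => f x ^ l)
        (hfm.pow_const l).aestronglyMeasurable]
      exact abs_integral_exp_dot_sub_pow_le w hR hl)
    (by positivity) hε
  convert key using 6
  simp only [hf, Finset.sum_sub_distrib, Finset.sum_const, Finset.card_univ, Fintype.card_fin,
    nsmul_eq_mul]
  field_simp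

lemma exists_measureReal_abs_mean_sq_sub_one_gt_le (k : ℕ) {δ : ℝ} (hδ : 0 < δ) :
    ∃ C : ℝ, 0 ≤ C ∧ ∀ d : ℕ, d ≠ 0 →
      (gaussianPi d).real {h | δ < |(d : ℝ)⁻¹ * ∑ m, (h m ^ 2 - 1)|} ≤ C / (d : ℝ) ^ k := by
  set f : ℝ → ℝ := fun x => x ^ 2 - 1 with hf
  have hfm : Measurable f := by fun_prop
  have hsq : ∀ l : ℕ, MemLp (fun x : ℝ => x ^ 2) l (gaussianReal 0 1) :=
    memLp_of_forall_integrable_pow (by fun_prop) fun l => by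
      simp_rw [← pow_mul]
      exact integrable_pow_of_forall_memLp (X := id) (fun l => memLp_id_gaussianReal' _ (by simp)) _
  have hfL : ∀ l : ℕ, MemLp f l (gaussianReal 0 1) := fun l => (hsq l).sub (memLp_const _)
  have hf0 : ∫ x, f x ∂(gaussianReal 0 1) = 0 := by
    have h1 : Integrable (fun x : ℝ => x ^ 2) (gaussianReal 0 1) := by
      simpa using integrable_pow_of_forall_memLp hsq 1
    have h2 := variance_fun_id_gaussianReal (μ := 0) (v := 1)
    rw [variance_of_integral_eq_zero (by fun_prop) (by simp)] at h2
    rw [hf, integral_sub h1 (integrable_const _), h2]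
    simp
  set B := ∑ l ∈ Finset.range (2 * k + 1), |∫ x, f x ^ l ∂(gaussianReal 0 1)| with hB
  have hB0 : 0 ≤ B := Finset.sum_nonneg fun _ _ => abs_nonneg _
  refine ⟨evenMomentConst B k / δ ^ (2 * k), div_nonneg (evenMomentConst_nonneg hB0 _)
    (by positivity), fun d hd => ?_⟩
  exact measureReal_abs_mean_gt_le (P := gaussianPi d) hd
    (X := fun m h => f (h m)) (iIndepFun_pi fun j => hfm.aemeasurable)
    (fun j => hfm.comp (measurable_pi_apply j))
    (fun j l => (hfL l).comp_measurePreserving (measurePreserving_eval _ j))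
    (fun j => by
      rw [integral_comp_eval (μ := fun _ : Fin d => gaussianReal 0 1) hfm.aestronglyMeasurable]
      exact hf0)
    k (fun j l hl => by
      rw [integral_comp_eval (μ := fun _ : Fin d => gaussianReal 0 1) (f := fun x => f x ^ l)
        (hfm.pow_const l).aestronglyMeasurable]
      exact Finset.single_le_sum (f := fun l => |∫ x, f x ^ l ∂(gaussianReal 0 1)|)
        (fun _ _ => abs_nonneg _) (Finset.mem_range.2 (by omega)))
    hB0 hδ

/-- For a standard Gaussian vector `h` and an independent Gaussian matrix `K`, this is the event
that the empirical mean over `j` of `exp (√(2c/d) ⟨h, K j⟩)` deviates from `exp c`. -/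
def deviationSet (c ε : ℝ) (d : ℕ) : Set ((Fin d → ℝ) × (Fin d → Fin d → ℝ)) :=
  {p | ε < |(d : ℝ)⁻¹ * ∑ j, Real.exp (∑ m, √(2 * c / d) * p.1 m * p.2 j m) - Real.exp c|}

lemma measurableSet_deviationSet (c ε : ℝ) (d : ℕ) : MeasurableSet (deviationSet c ε d) :=
  measurableSet_lt measurable_const (by fun_prop)

lemma notMem_deviationSet {c ε : ℝ} {d : ℕ} {h : Fin d → ℝ} {Q : Fin d → Fin d → ℝ} :
    (h, Q) ∉ deviationSet c ε d ↔
      |(d : ℝ)⁻¹ * ∑ j, Real.exp (∑ m, √(2 * c / d) * h m * Q j m) - Real.exp c| ≤ ε := by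
  rw [← not_lt]
  rfl

lemma exists_prod_deviationSet_le {c ε : ℝ} (hc : 0 < c) (hε : 0 < ε) (k : ℕ) :
    ∃ C : ℝ, 0 ≤ C ∧ ∀ d : ℕ, d ≠ 0 →
      ((gaussianPi d).prod (Measure.pi fun _ : Fin d => gaussianPi d)) (deviationSet c ε d) ≤
        ENNReal.ofReal (C / (d : ℝ) ^ k) := by
  obtain ⟨δ₀, hδ₀, hcont⟩ := Metric.continuousAt_iff.1 (Real.continuous_exp.continuousAt (x := c))
    (ε / 2) (by positivity)
  set δ := min (δ₀ / (2 * c)) 1 with hδ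
  have hδpos : 0 < δ := lt_min (by positivity) one_pos
  obtain ⟨C₁, hC₁, hχ⟩ := exists_measureReal_abs_mean_sq_sub_one_gt_le k hδpos
  set C₂ := evenMomentConst (2 * Real.exp ((2 * k : ℕ) ^ 2 * (2 * c))) k / (ε / 2) ^ (2 * k)
    with hC₂
  have hC₂0 : 0 ≤ C₂ := div_nonneg (evenMomentConst_nonneg (by positivity) _) (by positivity)
  refine ⟨C₁ + C₂, by positivity, fun d hd => ?_⟩
  have hd' : (0 : ℝ) < d := by exact_mod_cast Nat.pos_of_ne_zero hd
  set G : Set (Fin d → ℝ) := {h | δ < |(d : ℝ)⁻¹ * ∑ m, (h m ^ 2 - 1)|} with hG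
  have hGm : MeasurableSet G := measurableSet_lt measurable_const (by fun_prop)
  have hfiber : ∀ h ∉ G, (Measure.pi fun _ : Fin d => gaussianPi d)
      (Prod.mk h ⁻¹' deviationSet c ε d) ≤ ENNReal.ofReal (C₂ / (d : ℝ) ^ k) := by
    intro h hh
    have hh' : |(d : ℝ)⁻¹ * ∑ m, (h m ^ 2 - 1)| ≤ δ := not_lt.1 hh
    have hr : (∑ m, (√(2 * c / d) * h m) ^ 2) / 2
        = c + c * ((d : ℝ)⁻¹ * ∑ m, (h m ^ 2 - 1)) := by
      simp_rw [mul_pow, Real.sq_sqrt (show 0 ≤ 2 * c / d by positivity), ← Finset.mul_sum,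
        Finset.sum_sub_distrib]
      simp only [Finset.sum_const, Finset.card_univ, Fintype.card_fin, nsmul_eq_mul]
      field_simp
      ring
    have hr2 : (∑ m, (√(2 * c / d) * h m) ^ 2) / 2 ≤ 2 * c := by
      rw [hr]
      have := mul_le_mul_of_nonneg_left
        ((le_abs_self _).trans (hh'.trans (min_le_right _ _))) hc.le
      linarith
    have hclose : |Real.exp ((∑ m, (√(2 * c / d) * h m) ^ 2) / 2) - Real.exp c| < ε / 2 := by
      refine hcont ?_
      rw [hr, Real.dist_eq, add_sub_cancel_left, abs_mul, abs_of_pos hc]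
      have h1 := mul_le_mul_of_nonneg_left (hh'.trans (min_le_left _ _)) hc.le
      have h2 : c * (δ₀ / (2 * c)) = δ₀ / 2 := by field_simp
      linarith
    have := measureReal_abs_mean_exp_dot_sub_gt_le hd (fun m => √(2 * c / d) * h m) hr2 k
      (show 0 < ε / 2 by positivity)
    rw [← ofReal_measureReal]
    refine ENNReal.ofReal_le_ofReal (le_trans (measureReal_mono fun K hK => ?_) this)
    have hK' : ε < |(d : ℝ)⁻¹ * ∑ j, Real.exp (∑ m, √(2 * c / d) * h m * K j m) - Real.exp c| := hK
    change ε / 2 < _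
    have := abs_sub_le ((d : ℝ)⁻¹ * ∑ j, Real.exp (∑ m, √(2 * c / d) * h m * K j m))
      (Real.exp ((∑ m, (√(2 * c / d) * h m) ^ 2) / 2)) (Real.exp c)
    linarith
  rw [Measure.prod_apply (measurableSet_deviationSet c ε d)]
  calc _ ≤ ∫⁻ h, (G.indicator 1 h + ENNReal.ofReal (C₂ / (d : ℝ) ^ k)) ∂(gaussianPi d) := by
        refine lintegral_mono fun h => ?_
        by_cases hh : h ∈ G
        · simp only [Set.indicator_of_mem hh, Pi.one_apply]
          exact prob_le_one.trans le_self_add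
        · exact (hfiber h hh).trans le_add_self
    _ = gaussianPi d G + ENNReal.ofReal (C₂ / (d : ℝ) ^ k) := by
        rw [lintegral_add_right _ measurable_const, lintegral_indicator_one hGm]
        simp
    _ ≤ ENNReal.ofReal (C₁ / (d : ℝ) ^ k) + ENNReal.ofReal (C₂ / (d : ℝ) ^ k) := by
        gcongr
        rw [← ofReal_measureReal]
        exact ENNReal.ofReal_le_ofReal (hχ d hd)
    _ = _ := by
        rw [← ENNReal.ofReal_add (by positivity) (by positivity), add_div]

lemma map_add_div_sqrt_two_gaussianPi {d : ℕ} :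
    ((gaussianPi d).prod (gaussianPi d)).map (fun p m => (p.1 m + p.2 m) / √2) = gaussianPi d := by
  have h1 : ((gaussianReal 0 1).prod (gaussianReal 0 1)).map (fun p : ℝ × ℝ => (p.1 + p.2) / √2)
      = gaussianReal 0 1 := by
    have hX : ((gaussianReal 0 1).prod (gaussianReal 0 1)).map (Prod.fst : ℝ × ℝ → ℝ)
      = gaussianReal 0 1 := by simp
    have hY : ((gaussianReal 0 1).prod (gaussianReal 0 1)).map (Prod.snd : ℝ × ℝ → ℝ)
      = gaussianReal 0 1 := by simp
    have hind : IndepFun (Prod.fst : ℝ × ℝ → ℝ) (Prod.snd : ℝ × ℝ → ℝ)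
        ((gaussianReal 0 1).prod (gaussianReal 0 1)) :=
      indepFun_prod (X := id) (Y := id) measurable_id measurable_id
    have h2 := gaussianReal_add_gaussianReal_of_indepFun hind hX hY
    have h3 : (fun p : ℝ × ℝ => (p.1 + p.2) / √2) =
        (fun x => (√2)⁻¹ * x) ∘ ((Prod.fst : ℝ × ℝ → ℝ) + Prod.snd) := by
      ext p; simp [div_eq_inv_mul]
    rw [h3, ← Measure.map_map (by fun_prop) (by fun_prop), h2, gaussianReal_map_const_mul]
    congr 1
    · simp
    · ext
      simp
      norm_num
  have h4 := measurePreserving_arrowProdEquivProdArrow ℝ ℝ (Fin d) (fun _ => gaussianReal 0 1)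
    (fun _ => gaussianReal 0 1)
  rw [← h4.map_eq, Measure.map_map (by fun_prop) h4.measurable]
  have h5 := measurePreserving_pi (fun _ : Fin d => (gaussianReal 0 1).prod (gaussianReal 0 1))
    (fun _ : Fin d => gaussianReal 0 1) (f := fun _ p => (p.1 + p.2) / √2)
    fun _ => ⟨by fun_prop, h1⟩
  exact h5.map_eq

lemma map_eval_pi_gaussianPi {d : ℕ} (i : Fin d) :
    (Measure.pi fun _ : Fin d => gaussianPi d).map (fun Q => Q i) = gaussianPi d :=
  (measurePreserving_eval (fun _ : Fin d => gaussianPi d) i).map_eq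

lemma map_add_pi_gaussianPi {d : ℕ} {i k : Fin d} (hik : i ≠ k) :
    (Measure.pi fun _ : Fin d => gaussianPi d).map (fun Q m => (Q i m + Q k m) / √2) =
      gaussianPi d := by
  have hind : IndepFun (fun Q : Fin d → Fin d → ℝ => Q i) (fun Q => Q k)
      (Measure.pi fun _ : Fin d => gaussianPi d) :=
    (iIndepFun_pi (μ := fun _ : Fin d => gaussianPi d) (X := fun _ => id)
      fun _ => aemeasurable_id).indepFun hik
  have h1 := (indepFun_iff_map_prod_eq_prod_map_map (measurable_pi_apply i).aemeasurable
    (measurable_pi_apply k).aemeasurable).1 hind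
  rw [map_eval_pi_gaussianPi, map_eval_pi_gaussianPi] at h1
  have h2 := map_add_div_sqrt_two_gaussianPi (d := d)
  rw [← h1, Measure.map_map (by fun_prop) (by fun_prop)] at h2
  exact h2

lemma prod_preimage_deviationSet_le {c ε : ℝ} {d : ℕ} {a : ENNReal}
    (ha : ((gaussianPi d).prod (Measure.pi fun _ : Fin d => gaussianPi d)) (deviationSet c ε d) ≤ a)
    {h : (Fin d → Fin d → ℝ) → Fin d → ℝ} (hm : Measurable h)
    (hh : (Measure.pi fun _ : Fin d => gaussianPi d).map h = gaussianPi d) :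
    ((Measure.pi fun _ : Fin d => gaussianPi d).prod (Measure.pi fun _ : Fin d => gaussianPi d))
      ((fun p => (h p.1, p.2)) ⁻¹' deviationSet c ε d) ≤ a := by
  have hmp : MeasurePreserving h (Measure.pi fun _ : Fin d => gaussianPi d) (gaussianPi d) :=
    ⟨hm, hh⟩
  have := (hmp.prod (MeasurePreserving.id (Measure.pi fun _ : Fin d => gaussianPi d)))
  have h2 := this.measure_preimage (measurableSet_deviationSet c ε d).nullMeasurableSet
  rw [← h2] at ha
  exact ha

end Gaussian

section Attention

open scoped Matrix.Norms.L2Operator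

/-- The event that, for weights `(Q, K)`, one of the row normalizers, or one of the entries of the
Gram matrix of the exponentiated scores, deviates from its limit. -/
def badSet (β ε : ℝ) (d : ℕ) : Set ((Fin d → Fin d → ℝ) × (Fin d → Fin d → ℝ)) :=
  ⋃ i : Fin d, ⋃ k : Fin d,
    ((fun p => (p.1 i, p.2)) ⁻¹' deviationSet (β ^ 2 / 2) ε d ∪
      (fun p => (p.1 i, p.2)) ⁻¹' deviationSet (2 * β ^ 2) ε d) ∪
      if i = k then ∅ else
        (fun p => (fun m => (p.1 i m + p.1 k m) / √2, p.2)) ⁻¹' deviationSet (β ^ 2) ε d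

lemma measurableSet_badSet (β ε : ℝ) (d : ℕ) : MeasurableSet (badSet β ε d) := by
  refine MeasurableSet.iUnion fun i => MeasurableSet.iUnion fun k => ?_
  refine MeasurableSet.union (MeasurableSet.union ?_ ?_) ?_
  · exact (measurableSet_deviationSet _ _ _).preimage (by fun_prop)
  · exact (measurableSet_deviationSet _ _ _).preimage (by fun_prop)
  · split_ifs
    · exact MeasurableSet.empty
    · exact (measurableSet_deviationSet _ _ _).preimage (by fun_prop)

lemma exists_prod_badSet_le {β ε : ℝ} (hβ : 0 < β) (hε : 0 < ε) :
    ∃ C : ℝ, 0 ≤ C ∧ ∀ d : ℕ,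
      ((Measure.pi fun _ : Fin d => gaussianPi d).prod (Measure.pi fun _ : Fin d => gaussianPi d))
        (badSet β ε d) ≤ ENNReal.ofReal (C * (1 / (d : ℝ) ^ 2)) := by
  obtain ⟨C₁, h₁, H₁⟩ := exists_prod_deviationSet_le (c := β ^ 2 / 2) (by positivity) hε 4
  obtain ⟨C₂, h₂, H₂⟩ := exists_prod_deviationSet_le (c := 2 * β ^ 2) (by positivity) hε 4
  obtain ⟨C₃, h₃, H₃⟩ := exists_prod_deviationSet_le (c := β ^ 2) (by positivity) hε 4
  refine ⟨C₁ + C₂ + C₃, by positivity, fun d => ?_⟩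
  rcases eq_or_ne d 0 with rfl | hd
  · simp [badSet]
  have hd' : (0 : ℝ) < d := by exact_mod_cast Nat.pos_of_ne_zero hd
  refine (measure_iUnion_fintype_le _ _).trans ?_
  calc _ ≤ ∑ _i : Fin d, ∑ _k : Fin d, ENNReal.ofReal ((C₁ + C₂ + C₃) / (d : ℝ) ^ 4) := by
        refine Finset.sum_le_sum fun i _ => (measure_iUnion_fintype_le _ _).trans
          (Finset.sum_le_sum fun k _ => ?_)
        rw [add_div, add_div, ENNReal.ofReal_add (by positivity) (by positivity),
          ENNReal.ofReal_add (by positivity) (by positivity)]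
        refine (measure_union_le _ _).trans (add_le_add ((measure_union_le _ _).trans
          (add_le_add ?_ ?_)) ?_)
        · exact prod_preimage_deviationSet_le (H₁ d hd)
            (h := fun Q => Q i) (measurable_pi_apply i) (map_eval_pi_gaussianPi i)
        · exact prod_preimage_deviationSet_le (H₂ d hd)
            (h := fun Q => Q i) (measurable_pi_apply i) (map_eval_pi_gaussianPi i)
        · split_ifs with hik
          · simp
          · exact prod_preimage_deviationSet_le (H₃ d hd)
              (h := fun Q m => (Q i m + Q k m) / √2) (by fun_prop) (map_add_pi_gaussianPi hik)
    _ = _ := by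
        simp only [Finset.sum_const, Finset.card_univ, Fintype.card_fin, nsmul_eq_mul]
        rw [← ENNReal.ofReal_natCast, ← ENNReal.ofReal_mul (by positivity),
          ← ENNReal.ofReal_mul (by positivity)]
        congr 1
        field_simp

lemma norm_bounds_of_notMem_badSet {Ω : Type*} {β ε : ℝ} (hβ : 0 < β) (hε : 0 < ε) (hε1 : ε < 1)
    (WQ WK : (d : ℕ) → Ω → Fin d → Fin d → ℝ) {d : ℕ} (hd : d ≠ 0) {ω : Ω}
    (hω : (WQ d ω, WK d ω) ∉ badSet β ε d) {E : Matrix (Fin d) (Fin d) ℝ}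
    (hE : E = Matrix.of fun i j =>
      Real.exp (β * scoreS WQ WK d ω i j) / (Real.exp (β ^ 2 / 2) * d)) :
    |‖E‖ ^ 2 - 1| ≤ ε + (Real.exp (2 * β ^ 2) + 2) / √d ∧
      |‖attn β WQ WK d ω‖ - ‖E‖| ≤ ε * ‖attn β WQ WK d ω‖ := by
  have hd' : (0 : ℝ) < d := by exact_mod_cast Nat.pos_of_ne_zero hd
  have hsd : 0 < √(d : ℝ) := Real.sqrt_pos.2 hd'
  have hs2 : 0 < √(2 : ℝ) := by positivity
  set S := scoreS WQ WK d ω with hS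
  have hSij : ∀ i j, S i j = (√(d : ℝ))⁻¹ * ∑ m, WQ d ω i m * WK d ω j m := fun i j => by
    simp [hS, scoreS, Matrix.mul_apply]
  simp only [badSet, Set.mem_iUnion, Set.mem_union, not_exists, not_or, Set.mem_preimage] at hω
  have hrow : ∀ i, |(d : ℝ)⁻¹ * ∑ j, Real.exp (β * S i j) - Real.exp (β ^ 2 / 2)| ≤ ε := by
    intro i
    have h := notMem_deviationSet.1 (hω i i).1.1
    have hsq : √(2 * (β ^ 2 / 2) / d) = β / √d := by
      rw [show 2 * (β ^ 2 / 2) / (d : ℝ) = β ^ 2 / d by ring, Real.sqrt_div (by positivity),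
        Real.sqrt_sq hβ.le]
    convert h using 6 with j
    simp only [hsq, hSij, Finset.mul_sum]
    exact Finset.sum_congr rfl fun m _ => by ring
  have hdiag : ∀ i, |(d : ℝ)⁻¹ * ∑ j, Real.exp (β * S i j + β * S i j) - Real.exp (2 * β ^ 2)|
      ≤ ε := by
    intro i
    have h := notMem_deviationSet.1 (hω i i).1.2
    have hsq : √(2 * (2 * β ^ 2) / d) = 2 * β / √d := by
      rw [show 2 * (2 * β ^ 2) / (d : ℝ) = (2 * β) ^ 2 / d by ring, Real.sqrt_div (by positivity),
        Real.sqrt_sq (by positivity)]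
    convert h using 6 with j
    simp only [hsq, hSij, Finset.mul_sum, ← Finset.sum_add_distrib]
    exact Finset.sum_congr rfl fun m _ => by ring
  have hoff : ∀ i k, i ≠ k →
      |(d : ℝ)⁻¹ * ∑ j, Real.exp (β * S i j + β * S k j) - Real.exp (β ^ 2)| ≤ ε := by
    intro i k hik
    have h := (hω i k).2
    rw [if_neg hik] at h
    replace h := notMem_deviationSet.1 h
    have hsq : √(2 * β ^ 2 / d) = √2 * (β / √d) := by
      rw [show 2 * β ^ 2 / (d : ℝ) = 2 * (β ^ 2 / d) by ring, Real.sqrt_mul (by positivity),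
        Real.sqrt_div (by positivity), Real.sqrt_sq hβ.le]
    convert h using 6 with j
    simp only [hsq, hSij, Finset.mul_sum, ← Finset.sum_add_distrib]
    exact Finset.sum_congr rfl fun m _ => by field_simp
  have hgram : ∀ i k, d * (E * Eᵀ) i k =
      ((d : ℝ)⁻¹ * ∑ j, Real.exp (β * S i j + β * S k j)) / Real.exp (β ^ 2) := by
    intro i k
    have he : Real.exp (β ^ 2) = Real.exp (β ^ 2 / 2) * Real.exp (β ^ 2 / 2) := by
      rw [← Real.exp_add, add_halves]
    simp only [hE, Matrix.mul_apply, Matrix.transpose_apply, Matrix.of_apply, Finset.mul_sum,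
      Finset.sum_div, Real.exp_add, he]
    refine Finset.sum_congr rfl fun j _ => ?_
    field_simp
  have hexp1 : 1 ≤ Real.exp (β ^ 2) := Real.one_le_exp (by positivity)
  have hexp2 : 1 ≤ Real.exp (β ^ 2 / 2) := Real.one_le_exp (by positivity)
  refine ⟨?_, ?_⟩
  · refine abs_norm_sq_sub_one_le hd E hε.le (by positivity) (fun i k hik => ?_) fun i => ?_
    · rw [hgram, div_sub_one (by positivity), abs_div, abs_of_pos (Real.exp_pos (β ^ 2))]
      exact (div_le_self (abs_nonneg _) hexp1).trans (hoff i k hik)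
    · have h0 : 0 ≤ (d : ℝ)⁻¹ * ∑ j, Real.exp (β * S i j + β * S i j) := by positivity
      have h1 := (abs_le.1 (hdiag i)).2
      have h2 := div_le_self h0 hexp1
      have h3 := div_nonneg h0 (zero_le_one.trans hexp1)
      rw [hgram, abs_le]
      constructor <;> linarith [Real.exp_pos (2 * β ^ 2)]
  · set D : Fin d → ℝ := fun i =>
      ((d : ℝ)⁻¹ * ∑ j, Real.exp (β * S i j)) / Real.exp (β ^ 2 / 2) with hD
    have hD1 : ∀ i, |D i - 1| ≤ ε := fun i => by
      rw [hD, div_sub_one (by positivity), abs_div, abs_of_pos (Real.exp_pos (β ^ 2 / 2))]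
      exact (div_le_self (abs_nonneg _) hexp2).trans (hrow i)
    have hlow : ∀ i, 1 - ε ≤ D i := fun i => by linarith [(abs_le.1 (hD1 i)).1]
    have hup : ∀ i, D i ≤ 1 + ε := fun i => by linarith [(abs_le.1 (hD1 i)).2]
    have hpos : ∀ i, 0 < D i := fun i => by linarith [hlow i]
    have hA : attn β WQ WK d ω = Matrix.of fun i j => E i j / D i := by
      ext i j
      have hsum : 0 < ∑ k, Real.exp (β * S i k) :=
        Finset.sum_pos (fun _ _ => Real.exp_pos _) ⟨i, Finset.mem_univ i⟩
      simp only [attn, Matrix.of_apply, hE, hD, ← hS]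
      field_simp
    have hEA : E = Matrix.of fun i j => attn β WQ WK d ω i j / (D i)⁻¹ := by
      ext i j
      have := (hpos i).ne'
      simp only [hA, Matrix.of_apply]
      field_simp
    have h1 : ‖attn β WQ WK d ω‖ ≤ ‖E‖ / (1 - ε) := by
      rw [hA]
      exact norm_of_div_le E D (by linarith) hlow
    have h2 : ‖E‖ ≤ ‖attn β WQ WK d ω‖ / (1 + ε)⁻¹ := by
      conv_lhs => rw [hEA]
      exact norm_of_div_le _ _ (by positivity) fun i => inv_anti₀ (hpos i) (hup i)
    rw [le_div_iff₀ (by linarith)] at h1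
    rw [div_inv_eq_mul] at h2
    rw [abs_le]
    constructor <;> linarith

end Attention

lemma tendsto_one_of_approx {a e : ℕ → ℝ} (ha : ∀ d, 0 ≤ a d) (he : ∀ d, 0 ≤ e d) {C : ℝ}
    (h : ∀ ε : ℝ, 0 < ε → ∀ᶠ d : ℕ in atTop,
      |e d ^ 2 - 1| ≤ ε + C / √d ∧ |a d - e d| ≤ ε * a d) :
    Tendsto a atTop (nhds 1) ∧ Tendsto e atTop (nhds 1) := by
  have hC : Tendsto (fun d : ℕ => C / √(d : ℝ)) atTop (nhds 0) :=
    tendsto_const_nhds.div_atTop (Real.tendsto_sqrt_atTop.comp tendsto_natCast_atTop_atTop)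
  have hesq : Tendsto (fun d => e d ^ 2) atTop (nhds 1) := by
    refine Metric.tendsto_nhds.2 fun δ hδ => ?_
    filter_upwards [h (δ / 2) (by positivity), hC.eventually_lt_const (half_pos hδ)] with d h1 h2
    rw [Real.dist_eq]
    linarith [h1.1]
  have het : Tendsto e atTop (nhds 1) := by
    have := hesq.sqrt
    simpa [Real.sqrt_sq (he _)] using this
  refine ⟨?_, het⟩
  have hdiff : Tendsto (fun d => a d - e d) atTop (nhds 0) := by
    refine Metric.tendsto_nhds.2 fun δ hδ => ?_
    filter_upwards [h (min (1 / 2) (δ / 8)) (by positivity),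
      het.eventually_lt_const one_lt_two] with d h1 h2
    have h3 := h1.2.trans (mul_le_mul_of_nonneg_right (min_le_left _ _) (ha d))
    have h4 := h1.2.trans (mul_le_mul_of_nonneg_right (min_le_right _ _) (ha d))
    have h5 : a d < 4 := by linarith [le_abs_self (a d - e d)]
    rw [Real.dist_eq, sub_zero]
    nlinarith
  simpa using hdiff.add het

/-- Fix `β > 0`. Almost surely, `s_1(A_d) → 1` and
`s_1(exp(β S_d)/(e^{β²/2} d)) → 1` as `d → ∞`, `exp` being applied entrywise. -/
theorem stmt3 {Ω : Type*} [MeasurableSpace Ω] (P : Measure Ω) [IsProbabilityMeasure P]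
    (β : ℝ) (hβ : 0 < β)
    (WQ WK : (d : ℕ) → Ω → Fin d → Fin d → ℝ)
    (hlaw : ∀ d : ℕ, Measure.map (fun ω => (WQ d ω, WK d ω)) P =
      (Measure.pi fun _ : Fin d => Measure.pi fun _ : Fin d => gaussianReal 0 1).prod
        (Measure.pi fun _ : Fin d => Measure.pi fun _ : Fin d => gaussianReal 0 1)) :
    ∀ᵐ ω ∂P,
      Tendsto (fun d : ℕ => sOne (attn β WQ WK d ω)) atTop (nhds 1) ∧
      Tendsto (fun d : ℕ => sOne (Matrix.of fun i j : Fin d =>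
          Real.exp (β * scoreS WQ WK d ω i j) / (Real.exp (β ^ 2 / 2) * d)))
        atTop (nhds 1) := by
  have hae : ∀ n : ℕ, ∀ᵐ ω ∂P, ∀ᶠ d : ℕ in atTop,
      (WQ d ω, WK d ω) ∉ badSet β (1 / ((n : ℝ) + 2)) d := by
    intro n
    obtain ⟨C, -, hC⟩ := exists_prod_badSet_le (ε := 1 / ((n : ℝ) + 2)) hβ (by positivity)
    have hle : ∀ d, P ((fun ω => (WQ d ω, WK d ω)) ⁻¹' badSet β (1 / ((n : ℝ) + 2)) d) ≤
        ENNReal.ofReal (C * (1 / (d : ℝ) ^ 2)) := fun d => by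
      have hm : AEMeasurable (fun ω => (WQ d ω, WK d ω)) P :=
        AEMeasurable.of_map_ne_zero (by rw [hlaw d]; exact IsProbabilityMeasure.ne_zero _)
      rw [← Measure.map_apply_of_aemeasurable hm (measurableSet_badSet _ _ _), hlaw d]
      exact hC d
    have hsum : Summable fun d : ℕ => C * (1 / (d : ℝ) ^ 2) :=
      (Real.summable_one_div_nat_pow.2 one_lt_two).mul_left C
    exact ae_eventually_notMem (ne_top_of_le_ne_top hsum.tsum_ofReal_ne_top
      (ENNReal.tsum_le_tsum hle))
  filter_upwards [ae_all_iff.2 hae] with ω hω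
  refine tendsto_one_of_approx (C := Real.exp (2 * β ^ 2) + 2)
    (fun d => Real.iSup_nonneg fun i => Real.sqrt_nonneg _)
    (fun d => Real.iSup_nonneg fun i => Real.sqrt_nonneg _) fun ε hε => ?_
  obtain ⟨n, hn⟩ := exists_nat_one_div_lt hε
  have hn2 : 1 / ((n : ℝ) + 2) ≤ ε :=
    (one_div_le_one_div_of_le (by positivity) (by linarith)).trans hn.le
  have hn1 : 1 / ((n : ℝ) + 2) < 1 := by
    rw [div_lt_one (by positivity)]
    have : (0 : ℝ) ≤ n := n.cast_nonneg
    linarith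
  filter_upwards [hω n, eventually_ne_atTop 0] with d h hd
  have := norm_bounds_of_notMem_badSet hβ (by positivity) hn1 WQ WK hd h rfl
  simp only [← sOne_eq_norm] at this
  refine ⟨this.1.trans (by gcongr), this.2.trans ?_⟩
  exact mul_le_mul_of_nonneg_right hn2 (Real.iSup_nonneg fun i => Real.sqrt_nonneg _)
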